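/- If u is a solution of the imperfect-bonding conductivity problem with boundary data φ and constants U1, U2, then inf_{∂Ω} φ ≤ u(x) ≤ sup_{∂Ω} φ for every x ∈ Ω̃, and moreover inf_{∂Ω} φ ≤ U_j ≤ sup_{∂Ω} φ for j = 1, 2. -/

import Mathlib

open MeasureTheory Metric Set
open scoped RealInnerProductSpace ENNReal

noncomputable section

abbrev E (k : ℕ) := EuclideanSpace ℝ (Fin k)

/-- Laplacian: sum of pure second directional derivatives. -/
def elap {k : ℕ} (u : E k → ℝ) (x : E k) : ℝ :=
  ∑ i : Fin k, iteratedFDeriv ℝ 2 u x ![EuclideanSpace.single i 1, EuclideanSpace.single i 1]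

/-- `u` is a solution of the imperfect-bonding conductivity problem on
`Ω̃ := Ω ∖ (closure D1 ∪ closure D2)`, where `D_j` is the open ball with
center `p j` and radius `r j`, with boundary data `φ` and constants `U j`. -/
def IsCondSol {n : ℕ} (γ : ℝ) (Om : Set (E n)) (p : Fin 2 → E n) (r : Fin 2 → ℝ)
    (φ : E n → ℝ) (U : Fin 2 → ℝ) (u : E n → ℝ) : Prop :=
  -- Ω̃ and the interface spheres
  (fun Omt S =>
    ContinuousOn u (closure Omt) ∧
    ContDiffOn ℝ 2 u Omt ∧
    (∀ x ∈ Omt, elap u x = 0) ∧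
    (∀ x ∈ Omt ∪ S 0 ∪ S 1, DifferentiableAt ℝ u x) ∧
    ContinuousOn (fun x => gradient u x) (Omt ∪ S 0 ∪ S 1) ∧
    -- Robin conditions `u + γ ∂_ν u = U_j` on `∂D_j`, `ν(x) = (p j - x)/r j`
    (∀ j : Fin 2, ∀ x ∈ S j, u x + γ * ⟪(r j)⁻¹ • (p j - x), gradient u x⟫ = U j) ∧
    -- zero-flux conditions
    (∀ j : Fin 2, ∫ x in S j, ⟪(r j)⁻¹ • (p j - x), gradient u x⟫ ∂(μH[(n:ℝ) - 1]) = 0) ∧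
    -- boundary data
    (∀ x ∈ frontier Om, u x = φ x))
  (Om \ (closedBall (p 0) (r 0) ∪ closedBall (p 1) (r 1)))
  (fun j => sphere (p j) (r j))

/-- The standing geometric hypotheses: `Ω` bounded open, `D1`, `D2` open balls
with disjoint closures contained in `Ω`, with positive radii. -/
def CondGeom {n : ℕ} (Om : Set (E n)) (p : Fin 2 → E n) (r : Fin 2 → ℝ) : Prop :=
  IsOpen Om ∧ Bornology.IsBounded Om ∧ (∀ j, 0 < r j) ∧
  (∀ j, closedBall (p j) (r j) ⊆ Om) ∧
  Disjoint (closedBall (p 0) (r 0)) (closedBall (p 1) (r 1))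

open Filter Topology

theorem IsLocalMax.second_deriv_nonpos {h h' : ℝ → ℝ} {c a : ℝ} (hmax : IsLocalMax h a)
    (h1 : ∀ᶠ t in 𝓝 a, HasDerivAt h (h' t) t) (h2 : HasDerivAt h' c a) : c ≤ 0 := by
  by_contra! hc
  have he : deriv h =ᶠ[𝓝 a] h' := h1.mono fun t ht => ht.deriv
  have hdd : deriv (deriv h) a = c := by rw [he.deriv_eq, h2.deriv]
  have hmin : IsLocalMin h a :=
    isLocalMin_of_deriv_deriv_pos (hdd ▸ hc) hmax.deriv_eq_zero h1.self_of_nhds.continuousAt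
  have hconst : h =ᶠ[𝓝 a] fun _ => h a := by
    filter_upwards [hmax, hmin] with t ht ht' using le_antisymm ht ht'
  have : deriv (deriv h) a = 0 := by
    rw [hconst.deriv.deriv_eq]; simp
  linarith

/-- A quadratic barrier, vanishing at `z`, whose zero set is tangent to the hyperplane
`x i = z i`. -/
def barrier {n : ℕ} (i : Fin n) (z x : E n) : ℝ :=
  (x i - z i) + (n + 1) * (x i - z i) ^ 2 - ‖x - z‖ ^ 2

theorem continuous_barrier {n : ℕ} (i : Fin n) (z : E n) : Continuous (barrier i z) := by
  unfold barrier; fun_prop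

theorem barrier_add_smul_single {n : ℕ} (i k : Fin n) (z x : E n) (t : ℝ) :
    barrier i z (x + t • EuclideanSpace.single k 1) =
      barrier i z x + t * ((if i = k then 1 + 2 * (n + 1) * (x i - z i) else 0) - 2 * (x k - z k))
        + t ^ 2 * ((if i = k then (n + 1 : ℝ) else 0) - 1) := by
  have h1 : ‖x + t • EuclideanSpace.single k 1 - z‖ ^ 2
      = ‖x - z‖ ^ 2 + 2 * t * (x k - z k) + t ^ 2 := by
    rw [show x + t • EuclideanSpace.single k (1 : ℝ) - z
      = (x - z) + t • EuclideanSpace.single k 1 by abel, norm_add_sq_real, inner_smul_right,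
      EuclideanSpace.inner_single_right, norm_smul]
    simp [mul_assoc]
  unfold barrier
  rw [h1]
  by_cases hik : i = k
  · subst hik; simp; ring
  · simp [hik]; ring

theorem hasDerivAt_add_smul {n : ℕ} (x v : E n) (t : ℝ) :
    HasDerivAt (fun t : ℝ => x + t • v) v t := by
  simpa using ((hasDerivAt_id t).smul_const v).const_add x

theorem hasDerivAt_fderiv_add_smul {n : ℕ} {u : E n → ℝ} {x : E n} (hu : ContDiffAt ℝ 2 u x)
    (v : E n) :
    HasDerivAt (fun t : ℝ => fderiv ℝ u (x + t • v) v) (iteratedFDeriv ℝ 2 u x ![v, v]) 0 := by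
  have hf : DifferentiableAt ℝ (fderiv ℝ u) x :=
    (hu.fderiv_right (m := 1) (by norm_num)).differentiableAt (by simp)
  have hf' : HasFDerivAt (fun y => fderiv ℝ u y v)
      ((ContinuousLinearMap.apply ℝ ℝ v).comp (fderiv ℝ (fderiv ℝ u) x)) (x + (0 : ℝ) • v) := by
    rw [zero_smul, add_zero]
    exact (ContinuousLinearMap.apply ℝ ℝ v).hasFDerivAt.comp x hf.hasFDerivAt
  rw [iteratedFDeriv_two_apply]
  exact hf'.comp_hasDerivAt 0 (hasDerivAt_add_smul x v 0)

theorem elap_add_barrier_nonpos_of_isLocalMax {n : ℕ} {u : E n → ℝ} {x z : E n} {i : Fin n}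
    {ε : ℝ} (hu : ContDiffAt ℝ 2 u x)
    (hmax : IsLocalMax (fun y => u y + ε * barrier i z y) x) : elap u x + 2 * ε ≤ 0 := by
  have key : ∀ k : Fin n, iteratedFDeriv ℝ 2 u x
      ![EuclideanSpace.single k 1, EuclideanSpace.single k 1]
      + ε * (2 * ((if i = k then (n + 1 : ℝ) else 0) - 1)) ≤ 0 := by
    intro k
    set v : E n := EuclideanSpace.single k 1
    set b := (if i = k then 1 + 2 * (n + 1) * (x i - z i) else 0) - 2 * (x k - z k)
    set q := (if i = k then (n + 1 : ℝ) else 0) - 1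
    have hcont : Tendsto (fun t : ℝ => x + t • v) (𝓝 0) (𝓝 x) := by
      have := (hasDerivAt_add_smul x v 0).continuousAt.tendsto
      simpa using this
    have hmax' : IsLocalMax (fun t : ℝ => u (x + t • v) +
        ε * (barrier i z x + t * b + t ^ 2 * q)) 0 := by
      have := hcont.eventually hmax
      filter_upwards [this] with t ht
      rw [barrier_add_smul_single] at ht
      simpa using ht
    refine hmax'.second_deriv_nonpos
      (h' := fun t => fderiv ℝ u (x + t • v) v + ε * (b + 2 * t * q)) ?_ ?_
    · have hd : ∀ᶠ y in 𝓝 x, DifferentiableAt ℝ u y :=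
        (hu.eventually (by simp)).mono fun y hy => hy.differentiableAt (by simp)
      filter_upwards [hcont.eventually hd] with t ht
      refine (ht.hasFDerivAt.comp_hasDerivAt t (hasDerivAt_add_smul x v t)).add (HasDerivAt.const_mul ε ?_)
      have := (((hasDerivAt_id t).mul_const b).const_add (barrier i z x)).fun_add
        ((hasDerivAt_pow 2 t).mul_const q)
      simpa using this
    · refine (hasDerivAt_fderiv_add_smul hu v).add (HasDerivAt.const_mul ε ?_)
      have := (((hasDerivAt_id (0 : ℝ)).const_mul 2).mul_const q).const_add b
      simpa using this
  have hs := Finset.sum_nonpos fun k (_ : k ∈ Finset.univ) => key k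
  rw [Finset.sum_add_distrib, ← Finset.mul_sum, ← Finset.mul_sum, Finset.sum_sub_distrib] at hs
  simp only [Finset.sum_ite_eq, Finset.mem_univ, if_true, Finset.sum_const, Finset.card_univ,
    Fintype.card_fin, nsmul_eq_mul, mul_one] at hs
  unfold elap
  linarith

theorem HasDerivAt.le_of_eventually_le {g : ℝ → ℝ} {g' c : ℝ} (hg : HasDerivAt g g' 0)
    (hle : ∀ᶠ t in 𝓝[>] 0, g t ≤ g 0 + c * t) : g' ≤ c := by
  refine le_of_tendsto ((hasDerivWithinAt_iff_tendsto_slope' (s := Ioi (0 : ℝ)) (by simp)).1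
    hg.hasDerivWithinAt) ?_
  filter_upwards [self_mem_nhdsWithin, hle] with t (ht : 0 < t) h
  rw [slope_def_field, sub_zero, div_le_iff₀ ht]
  linarith

theorem DifferentiableAt.hasDerivAt_add_smul {n : ℕ} {u : E n → ℝ} {z : E n}
    (hd : DifferentiableAt ℝ u z) (v : E n) :
    HasDerivAt (fun t : ℝ => u (z + t • v)) (fderiv ℝ u z v) 0 := by
  have h2 : HasFDerivAt u (fderiv ℝ u z) (z + (0 : ℝ) • v) := by simpa using hd.hasFDerivAt
  exact h2.comp_hasDerivAt 0 (_root_.hasDerivAt_add_smul z v 0)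

/-- Hopf's boundary point lemma for half balls. -/
theorem fderiv_single_neg_of_half_ball {n : ℕ} {u : E n → ℝ} {W : Set (E n)} (hW : IsOpen W)
    (hu : ContDiffOn ℝ 2 u W) (hharm : ∀ x ∈ W, elap u x = 0) {z : E n} {i : Fin n} {δ : ℝ}
    (hδ : 0 < δ) (hz : ∀ x, ‖x - z‖ ≤ δ → z i < x i → x ∈ W ∧ u x < u z)
    (hd : DifferentiableAt ℝ u z) : fderiv ℝ u z (EuclideanSpace.single i 1) < 0 := by
  have hn : (0 : ℝ) < n + 1 := by positivity
  wlog hδn : (n + 1) * δ ≤ 1 / 2 generalizing δ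
  · refine this (δ := min δ (1 / 2 / (n + 1))) (by positivity)
      (fun x hx => hz x (hx.trans (min_le_left _ _))) ?_
    calc (n + 1) * min δ (1 / 2 / (n + 1)) ≤ (n + 1) * (1 / 2 / (n + 1 : ℝ)) := by
          gcongr; exact min_le_right _ _
      _ = 1 / 2 := by field_simp
  have hδ2 : δ ≤ 1 / 2 := by nlinarith [(Nat.cast_nonneg n : (0 : ℝ) ≤ n)]
  have habs : ∀ x : E n, |x i - z i| ≤ ‖x - z‖ := fun x => by
    simpa using PiLp.norm_apply_le (x - z) i
  set G : Set (E n) := closedBall z δ ∩ {x | 0 ≤ barrier i z x} with hG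
  have hGc : IsCompact G := (isCompact_closedBall z δ).inter_right
    (isClosed_le continuous_const (continuous_barrier i z))
  have hzG : z ∈ G := ⟨by simp [hδ.le], by simp [barrier]⟩
  have hpos : ∀ x ∈ G, x ≠ z → x ∈ W ∧ u x < u z := by
    rintro x ⟨hx1, hx2⟩ hxz
    rw [mem_closedBall, dist_eq_norm] at hx1
    refine hz x hx1 ?_
    have h0 : 0 < ‖x - z‖ := norm_pos_iff.2 (sub_ne_zero.2 hxz)
    have h1 := abs_le.1 ((habs x).trans hx1)
    have h2 : 0 ≤ (x i - z i) + (n + 1) * (x i - z i) ^ 2 - ‖x - z‖ ^ 2 := hx2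
    have h3 : 0 < (x i - z i) * (1 + (n + 1) * (x i - z i)) := by nlinarith
    have h4 : 0 < 1 + (n + 1) * (x i - z i) := by nlinarith
    linarith [pos_of_mul_pos_left h3 h4.le]
  have hcont : ContinuousOn u G := by
    intro x hx
    by_cases hxz : x = z
    · subst hxz; exact hd.continuousAt.continuousWithinAt
    · exact (hu.continuousOn.continuousAt
        (hW.mem_nhds (hpos x hx hxz).1)).continuousWithinAt
  obtain ⟨η, hη, hηu⟩ : ∃ η > 0, ∀ x ∈ G ∩ sphere z δ, u x ≤ u z - η := by
    rcases (G ∩ sphere z δ).eq_empty_or_nonempty with he | hne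
    · exact ⟨1, one_pos, by simp [he]⟩
    · obtain ⟨y, hy, hymax⟩ := (hGc.inter_right isClosed_sphere).exists_isMaxOn hne
        (hcont.mono inter_subset_left)
      have hyz : y ≠ z := by
        rintro rfl; have := hy.2; simp at this; linarith
      refine ⟨u z - u y, sub_pos.2 (hpos y hy.1 hyz).2, fun x hx => ?_⟩
      have : u x ≤ u y := hymax hx
      linarith
  have hb1 : ∀ x ∈ G, barrier i z x ≤ 1 := by
    rintro x ⟨hx1, -⟩
    rw [mem_closedBall, dist_eq_norm] at hx1
    have h1 := abs_le.1 ((habs x).trans hx1)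
    have h5 : (x i - z i) ^ 2 ≤ δ ^ 2 := by nlinarith
    have h6 : (n + 1) * (x i - z i) ^ 2 ≤ (n + 1) * δ ^ 2 := by gcongr
    unfold barrier
    nlinarith [sq_nonneg ‖x - z‖]
  have hle : ∀ x ∈ G, u x + η * barrier i z x ≤ u z := by
    obtain ⟨y, hy, hymax⟩ := hGc.exists_isMaxOn ⟨z, hzG⟩
      (hcont.add ((continuous_barrier i z).continuousOn.const_smul η))
    intro x hx
    refine le_trans (hymax hx) ?_
    change u y + η * barrier i z y ≤ u z
    by_contra! hlt
    have huy : u y ≤ u z := by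
      by_cases hyz : y = z
      · rw [hyz]
      · exact (hpos y hy hyz).2.le
    have hyb : 0 < barrier i z y := by
      by_contra! h
      nlinarith
    have hyz : y ≠ z := by
      rintro rfl; simp [barrier] at hyb
    have hys : y ∈ ball z δ := by
      have h1 : dist y z ≤ δ := hy.1
      refine lt_of_le_of_ne h1 fun h => ?_
      have := hηu y ⟨hy, h⟩
      nlinarith [hb1 y hy]
    have hloc : IsLocalMax (fun x => u x + η * barrier i z x) y := by
      filter_upwards [isOpen_ball.mem_nhds hys,
        (continuous_barrier i z).continuousAt.eventually (lt_mem_nhds hyb)] with x hx1 hx2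
      exact hymax ⟨ball_subset_closedBall hx1, hx2.le⟩
    have hyW := (hpos y hy hyz).1
    have := elap_add_barrier_nonpos_of_isLocalMax (hu.contDiffAt (hW.mem_nhds hyW)) hloc
    rw [hharm y hyW] at this
    linarith
  set v : E n := EuclideanSpace.single i 1
  have : fderiv ℝ u z v ≤ -η := by
    refine (hd.hasDerivAt_add_smul v).le_of_eventually_le ?_
    filter_upwards [self_mem_nhdsWithin, mem_nhdsWithin_of_mem_nhds (gt_mem_nhds hδ)]
      with t (ht : 0 < t) htδ
    have hbar : barrier i z (z + t • v) = t + t ^ 2 * n := by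
      rw [barrier_add_smul_single]; simp [barrier]
    have hmem : z + t • v ∈ G := by
      refine ⟨?_, ?_⟩
      · simp [v, norm_smul, abs_of_pos ht, htδ.le]
      · rw [mem_ofPred_eq, hbar]; positivity
    have h1 := hle _ hmem
    rw [hbar] at h1
    rw [zero_smul, add_zero]
    have : 0 ≤ η * (t ^ 2 * n) := by positivity
    linarith
  linarith

/-- Radial projection onto `sphere p r` of a face of the cube centred at `p`. -/
def cubeFaceToSphere {m : ℕ} (p : E (m + 1)) (r : ℝ) (i : Fin (m + 1)) (s : ℝ)
    (y : Fin m → ℝ) : E (m + 1) :=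
  p + (r * ‖(WithLp.toLp 2 (i.insertNth s y : Fin (m + 1) → ℝ) : E (m + 1))‖⁻¹) •
    WithLp.toLp 2 (i.insertNth s y : Fin (m + 1) → ℝ)

theorem contDiff_cubeFaceToSphere {m : ℕ} (p : E (m + 1)) (r : ℝ) (i : Fin (m + 1)) {s : ℝ}
    (hs : s ≠ 0) : ContDiff ℝ 1 (cubeFaceToSphere p r i s) := by
  have hins : ContDiff ℝ 1 fun y : Fin m → ℝ =>
      (WithLp.toLp 2 (i.insertNth s y : Fin (m + 1) → ℝ) : E (m + 1)) := by
    rw [contDiff_euclidean]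
    refine (Fin.forall_iff_succAbove i).2 ⟨?_, fun k => ?_⟩
    · simpa using contDiff_const
    · simpa using contDiff_apply ℝ ℝ k
  refine contDiff_const.add (ContDiff.fun_smul (contDiff_const.mul (ContDiff.inv ?_ ?_)) hins)
  · refine hins.norm ℝ fun y hy => hs ?_
    simpa using congrArg (fun v : E (m + 1) => v i) hy
  · refine fun y hy => hs ?_
    simpa using congrArg (fun v : E (m + 1) => v i) (norm_eq_zero.1 hy)

theorem sphere_subset_iUnion_cubeFaceToSphere {m : ℕ} (p : E (m + 1)) {r : ℝ} (hr : 0 < r) :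
    sphere p r ⊆ ⋃ i : Fin (m + 1), ⋃ s ∈ ({1, -1} : Finset ℝ),
      cubeFaceToSphere p r i s '' closedBall 0 1 := by
  intro x hx
  rw [mem_sphere, dist_eq_norm] at hx
  obtain ⟨i, -, hi⟩ := Finset.exists_max_image Finset.univ (fun k => |(x - p) k|)
    ⟨0, Finset.mem_univ _⟩
  have hdi : 0 < |(x - p) i| := by
    rw [abs_pos]
    intro h0
    have : x - p = 0 := by
      ext k
      have := hi k (Finset.mem_univ _)
      simpa [h0] using this
    rw [this, norm_zero] at hx
    linarith
  have hins : (WithLp.toLp 2 (i.insertNth ((x - p) i / |(x - p) i|)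
      (fun k => (x - p) (i.succAbove k) / |(x - p) i|) : Fin (m + 1) → ℝ) : E (m + 1))
      = |(x - p) i|⁻¹ • (x - p) := by
    ext k
    revert k
    refine (Fin.forall_iff_succAbove i).2 ⟨?_, fun k => ?_⟩ <;> simp [div_eq_inv_mul]
  simp only [mem_iUnion]
  refine ⟨i, (x - p) i / |(x - p) i|, ?_, fun k => (x - p) (i.succAbove k) / |(x - p) i|, ?_, ?_⟩
  · rcases abs_choice ((x - p) i) with h | h
    · rw [h] at hdi ⊢; exact Finset.mem_insert.2 (Or.inl (div_self hdi.ne'))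
    · have : (x - p) i ≠ 0 := abs_pos.1 hdi
      rw [h, div_neg, div_self this]; simp
  · rw [mem_closedBall_zero_iff, pi_norm_le_iff_of_nonneg zero_le_one]
    intro k
    rw [Real.norm_eq_abs, abs_div, abs_abs, div_le_one hdi]
    exact hi _ (Finset.mem_univ _)
  · rw [cubeFaceToSphere, hins, norm_smul, norm_inv, Real.norm_eq_abs, abs_abs, hx, smul_smul,
      mul_inv, inv_inv]
    rw [show r * (|(x - p) i| * r⁻¹) * |(x - p) i|⁻¹ = 1 by field_simp]
    simp

theorem hausdorffMeasure_pi_fin (m : ℕ) : (μH[(m : ℝ)] : Measure (Fin m → ℝ)) = volume := by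
  have := hausdorffMeasure_pi_real (ι := Fin m)
  rwa [Fintype.card_fin] at this

theorem hausdorffMeasure_sphere_lt_top {m : ℕ} (p : E (m + 1)) {r : ℝ} (hr : 0 < r) :
    μH[(m : ℝ)] (sphere p r) < ∞ := by
  refine (measure_mono (sphere_subset_iUnion_cubeFaceToSphere p hr)).trans_lt ?_
  refine (measure_iUnion_fintype_le _ _).trans_lt (ENNReal.sum_lt_top.2 fun i _ => ?_)
  refine (measure_biUnion_finset_le _ _).trans_lt (ENNReal.sum_lt_top.2 fun s hs => ?_)
  have hs0 : s ≠ 0 := by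
    rintro rfl; simp at hs
  obtain ⟨K, hK⟩ := ((contDiff_cubeFaceToSphere p r i hs0).locallyLipschitz.locallyLipschitzOn
    (s := closedBall 0 1)).exists_lipschitzOnWith_of_compact (isCompact_closedBall _ _)
  refine (hK.hausdorffMeasure_image_le (Nat.cast_nonneg m)).trans_lt ?_
  rw [hausdorffMeasure_pi_fin, ENNReal.rpow_natCast]
  exact ENNReal.mul_lt_top (ENNReal.pow_lt_top ENNReal.coe_lt_top)
    (isCompact_closedBall _ _).measure_lt_top

/-- The upper hemisphere of `sphere p r` as a graph over the last coordinates. -/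
def hemisphereGraph {m : ℕ} (p : E (m + 1)) (r : ℝ) (y : Fin m → ℝ) : E (m + 1) :=
  p + WithLp.toLp 2 (Fin.cons √(r ^ 2 - ∑ k, y k ^ 2) y : Fin (m + 1) → ℝ)

theorem continuous_hemisphereGraph {m : ℕ} (p : E (m + 1)) (r : ℝ) :
    Continuous (hemisphereGraph p r) := by
  refine continuous_const.add ((PiLp.continuous_toLp 2 _).comp (continuous_pi fun k => ?_))
  refine Fin.cases ?_ (fun k => ?_) k
  · simp only [Fin.cons_zero]; fun_prop
  · simp only [Fin.cons_succ]; fun_prop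

theorem hemisphereGraph_mem_sphere {m : ℕ} (p : E (m + 1)) {r : ℝ} (hr : 0 < r)
    {y : Fin m → ℝ} (hy : ∑ k, y k ^ 2 < r ^ 2) : hemisphereGraph p r y ∈ sphere p r := by
  rw [mem_sphere, dist_eq_norm, hemisphereGraph, add_sub_cancel_left, EuclideanSpace.norm_eq,
    Real.sqrt_eq_iff_eq_sq (by positivity) hr.le, Fin.sum_univ_succ]
  simp only [Fin.cons_zero, Fin.cons_succ, Real.norm_eq_abs, sq_abs]
  rw [Real.sq_sqrt (by linarith)]
  ring

theorem hausdorffMeasure_inter_sphere_pos {m : ℕ} (p : E (m + 1)) {r : ℝ} (hr : 0 < r)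
    {V : Set (E (m + 1))} (hV : V ∈ 𝓝 (p + r • EuclideanSpace.single 0 1)) :
    0 < μH[(m : ℝ)] (V ∩ sphere p r) := by
  have h0 : hemisphereGraph p r 0 = p + r • EuclideanSpace.single 0 1 := by
    ext k
    refine Fin.cases ?_ (fun k => ?_) k <;> simp [hemisphereGraph, Real.sqrt_sq hr.le]
  have hW : hemisphereGraph p r ⁻¹' V ∩ {y | ∑ k, y k ^ 2 < r ^ 2} ∈ 𝓝 (0 : Fin m → ℝ) := by
    refine inter_mem ((continuous_hemisphereGraph p r).continuousAt.preimage_mem_nhds (h0 ▸ hV))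
      ((isOpen_lt (by fun_prop) continuous_const).mem_nhds ?_)
    simpa using pow_pos hr 2
  let P : E (m + 1) → Fin m → ℝ := fun x k => x k.succ - p k.succ
  have hP : LipschitzWith 1 P := by
    refine LipschitzWith.of_dist_le_mul fun x y => ?_
    rw [NNReal.coe_one, one_mul, dist_pi_le_iff dist_nonneg]
    intro k
    rw [dist_eq_norm x y, Real.dist_eq]
    simpa [P] using PiLp.norm_apply_le (x - y) k.succ
  have hsub : hemisphereGraph p r ⁻¹' V ∩ {y | ∑ k, y k ^ 2 < r ^ 2} ⊆ P '' (V ∩ sphere p r) :=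
    fun y hy => ⟨_, ⟨hy.1, hemisphereGraph_mem_sphere p hr hy.2⟩, by
      ext k; simp [P, hemisphereGraph]⟩
  calc 0 < volume (hemisphereGraph p r ⁻¹' V ∩ {y | ∑ k, y k ^ 2 < r ^ 2}) :=
        Measure.measure_pos_of_mem_nhds volume hW
    _ = μH[(m : ℝ)] (hemisphereGraph p r ⁻¹' V ∩ {y | ∑ k, y k ^ 2 < r ^ 2}) := by
        rw [hausdorffMeasure_pi_fin]
    _ ≤ μH[(m : ℝ)] (P '' (V ∩ sphere p r)) := measure_mono hsub
    _ ≤ μH[(m : ℝ)] (V ∩ sphere p r) := by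
        simpa using hP.hausdorffMeasure_image_le (Nat.cast_nonneg m) (V ∩ sphere p r)

theorem eq_zero_at_pole_of_setIntegral_sphere_eq_zero {m : ℕ} (p : E (m + 1)) {r : ℝ} (hr : 0 < r)
    {f : E (m + 1) → ℝ} (hf : ContinuousOn f (sphere p r)) (hnn : ∀ x ∈ sphere p r, 0 ≤ f x)
    (hint : ∫ x in sphere p r, f x ∂μH[(m : ℝ)] = 0) :
    f (p + r • EuclideanSpace.single 0 1) = 0 := by
  set q : E (m + 1) := p + r • EuclideanSpace.single 0 1
  have hq : q ∈ sphere p r := by simp [q, norm_smul, abs_of_pos hr]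
  have hS : MeasurableSet (sphere p r) := isClosed_sphere.measurableSet
  have hfi : IntegrableOn f (sphere p r) μH[(m : ℝ)] :=
    hf.integrableOn_of_subset_isCompact (isCompact_sphere p r) hS subset_rfl
      (hausdorffMeasure_sphere_lt_top p hr).ne
  have hae := (setIntegral_eq_zero_iff_of_nonneg_ae
    ((ae_restrict_iff' hS).2 (Eventually.of_forall hnn)) hfi).1 hint
  by_contra hne
  obtain ⟨V, hV, hVf⟩ := mem_nhdsWithin_iff_exists_mem_nhds_inter.1
    ((hf q hq).eventually_ne hne)
  refine (hausdorffMeasure_inter_sphere_pos p hr hV).ne' (measure_mono_null ?_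
    (ae_iff.1 ((ae_restrict_iff' hS).1 hae)))
  exact fun x hx h => hVf hx (h hx.2)

theorem sphere_subset_union_spheres {n : ℕ} (W : Set (E n)) (p : Fin 2 → E n) (r : Fin 2 → ℝ)
    (j : Fin 2) : sphere (p j) (r j) ⊆ W ∪ sphere (p 0) (r 0) ∪ sphere (p 1) (r 1) := by
  revert j
  rw [Fin.forall_fin_two]
  exact ⟨fun _ hx => Or.inl (Or.inr hx), fun _ hx => Or.inr hx⟩

theorem CondGeom.eventually_mem {n : ℕ} {Om : Set (E n)} {p : Fin 2 → E n} {r : Fin 2 → ℝ}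
    (h : CondGeom Om p r) {j : Fin 2} {x : E n} (hx : x ∈ closedBall (p j) (r j)) :
    ∀ᶠ y in 𝓝 x, y ∉ closedBall (p j) (r j) →
      y ∈ Om \ (closedBall (p 0) (r 0) ∪ closedBall (p 1) (r 1)) := by
  obtain ⟨ho, -, -, hsub, hdisj⟩ := h
  have hother : ∀ᶠ y in 𝓝 x, ∀ k, k ≠ j → y ∉ closedBall (p k) (r k) := by
    refine eventually_all.2 fun k => ?_
    by_cases hkj : k = j
    · simp [hkj]
    · have hxk : x ∉ closedBall (p k) (r k) := by
        have hpair : ∀ a b : Fin 2, a ≠ b →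
            Disjoint (closedBall (p a) (r a)) (closedBall (p b) (r b)) := by
          simp [Fin.forall_fin_two, hdisj, hdisj.symm]
        exact disjoint_left.1 (hpair j k (Ne.symm hkj)) hx
      filter_upwards [isClosed_closedBall.isOpen_compl.mem_nhds hxk] with y hy _ using hy
  filter_upwards [hother, ho.mem_nhds (hsub j hx)] with y hy hyO hyj
  have : ∀ k, y ∉ closedBall (p k) (r k) := fun k => by
    by_cases hkj : k = j
    · exact hkj ▸ hyj
    · exact hy k hkj
  exact ⟨hyO, fun h => h.elim (this 0) (this 1)⟩

theorem CondGeom.sphere_subset_closure {n : ℕ} {Om : Set (E n)} {p : Fin 2 → E n}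
    {r : Fin 2 → ℝ} (h : CondGeom Om p r) (j : Fin 2) :
    sphere (p j) (r j) ⊆ closure (Om \ (closedBall (p 0) (r 0) ∪ closedBall (p 1) (r 1))) := by
  intro x hx
  have hxc : x ∈ closure (closedBall (p j) (r j))ᶜ := by
    rw [closure_compl, interior_closedBall _ (h.2.2.1 j).ne']
    simp [mem_sphere.1 hx]
  rw [mem_closure_iff_frequently] at hxc ⊢
  exact (hxc.and_eventually (h.eventually_mem (sphere_subset_closedBall hx))).mono
    fun y hy => hy.2 hy.1

theorem CondGeom.closure_subset {n : ℕ} {Om : Set (E n)} {p : Fin 2 → E n}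
    {r : Fin 2 → ℝ} (h : CondGeom Om p r) {x : E n}
    (hx : x ∈ closure (Om \ (closedBall (p 0) (r 0) ∪ closedBall (p 1) (r 1)))) :
    x ∈ frontier Om ∨ x ∈ Om \ (closedBall (p 0) (r 0) ∪ closedBall (p 1) (r 1)) ∨
      ∃ j, x ∈ sphere (p j) (r j) := by
  by_cases hxO : x ∈ Om
  swap
  · exact Or.inl (h.1.frontier_eq ▸ ⟨closure_mono sdiff_subset hx, hxO⟩)
  refine Or.inr (or_iff_not_imp_left.2 fun hxn => ?_)
  obtain ⟨j, hj⟩ : ∃ j, x ∈ closedBall (p j) (r j) := by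
    by_contra! hcon
    exact hxn ⟨hxO, fun h => h.elim (hcon 0) (hcon 1)⟩
  refine ⟨j, le_antisymm hj (not_lt.1 fun hlt => ?_)⟩
  obtain ⟨y, hy, hyO⟩ := mem_closure_iff.1 hx (ball (p j) (r j)) isOpen_ball hlt
  refine hyO.2 ?_
  have hsub : ∀ k, closedBall (p k) (r k) ⊆ closedBall (p 0) (r 0) ∪ closedBall (p 1) (r 1) := by
    simp [Fin.forall_fin_two]
  exact hsub j (ball_subset_closedBall hy)

theorem IsCondSol.neg {n : ℕ} {γ : ℝ} {Om : Set (E n)} {p : Fin 2 → E n} {r : Fin 2 → ℝ}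
    {φ : E n → ℝ} {U : Fin 2 → ℝ} {u : E n → ℝ} (h : IsCondSol γ Om p r φ U u) :
    IsCondSol γ Om p r (-φ) (-U) (-u) := by
  obtain ⟨hc, h2, hl, hd, hg, hR, hF, hb⟩ := h
  have hgrad : ∀ x, gradient (-u) x = -gradient u x := fun x => by
    simp [gradient, fderiv_neg]
  refine ⟨hc.neg, h2.neg, fun x hx => ?_, fun x hx => (hd x hx).neg, ?_, fun j x hx => ?_,
    fun j => ?_, fun x hx => congrArg _ (hb x hx)⟩
  · have := hl x hx
    simp only [elap, iteratedFDeriv_neg_apply, neg_apply,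
      Finset.sum_neg_distrib] at this ⊢
    rw [this, neg_zero]
  · simp only [hgrad]; exact hg.neg
  · rw [hgrad, inner_neg_right, Pi.neg_apply, Pi.neg_apply, ← hR j x hx]; ring
  · simp only [hgrad, inner_neg_right]
    rw [integral_neg, hF j, neg_zero]

theorem IsCondSol.pole {m : ℕ} {γ : ℝ} (hγ : 0 < γ) {Om : Set (E (m + 1))}
    {p : Fin 2 → E (m + 1)} {r : Fin 2 → ℝ} (hgeom : CondGeom Om p r) {φ : E (m + 1) → ℝ}
    {U : Fin 2 → ℝ} {u : E (m + 1) → ℝ} (h : IsCondSol γ Om p r φ U u) (j : Fin 2)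
    (hle : ∀ x ∈ sphere (p j) (r j), u x ≤ U j) :
    u (p j + r j • EuclideanSpace.single 0 1) = U j ∧
      fderiv ℝ u (p j + r j • EuclideanSpace.single 0 1) (EuclideanSpace.single 0 1) = 0 := by
  obtain ⟨-, -, -, -, hg, hR, hF, -⟩ := h
  have hr := hgeom.2.2.1 j
  have hint := hF j
  rw [show ((m + 1 : ℕ) : ℝ) - 1 = m by push_cast; ring] at hint
  have hν : Continuous fun x : E (m + 1) => (r j)⁻¹ • (p j - x) := by fun_prop
  have h0 := eq_zero_at_pole_of_setIntegral_sphere_eq_zero (p j) hr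
    (hν.continuousOn.inner (hg.mono (sphere_subset_union_spheres _ p r j)))
    (fun x hx => by
      have h1 := hR j x hx
      have h2 := hle x hx
      by_contra! hneg
      nlinarith) hint
  have hq : p j + r j • EuclideanSpace.single 0 1 ∈ sphere (p j) (r j) := by
    simp [norm_smul, abs_of_pos hr]
  have h1 := hR j _ hq
  rw [h0, mul_zero, add_zero] at h1
  refine ⟨h1, ?_⟩
  rw [sub_add_cancel_left, smul_neg, smul_smul, inv_mul_cancel₀ hr.ne', one_smul, inner_neg_left,
    neg_eq_zero, real_inner_comm, inner_gradient_left] at h0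
  exact h0

theorem IsCondSol.le_of_isMaxOn_of_mem_sphere {n : ℕ} {γ : ℝ} (hγ : 0 < γ) {Om : Set (E n)}
    {p : Fin 2 → E n} {r : Fin 2 → ℝ} (hgeom : CondGeom Om p r) {φ : E n → ℝ}
    {U : Fin 2 → ℝ} {u : E n → ℝ} (h : IsCondSol γ Om p r φ U u) {j : Fin 2} {z : E n}
    (hz : z ∈ sphere (p j) (r j))
    (hmax : IsMaxOn u (Om \ (closedBall (p 0) (r 0) ∪ closedBall (p 1) (r 1))) z) :
    u z ≤ U j := by
  obtain ⟨-, -, -, hd, -, hR, -, -⟩ := h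
  have hr := hgeom.2.2.1 j
  have hdz : DifferentiableAt ℝ u z :=
    hd z (sphere_subset_union_spheres _ p r j hz)
  have hderiv : fderiv ℝ u z (z - p j) ≤ 0 := by
    refine (hdz.hasDerivAt_add_smul (z - p j)).le_of_eventually_le ?_
    have hcont : Tendsto (fun t : ℝ => z + t • (z - p j)) (𝓝[>] 0) (𝓝 z) := by
      have := (hasDerivAt_add_smul z (z - p j) 0).continuousAt.tendsto
      rw [zero_smul, add_zero] at this
      exact this.mono_left nhdsWithin_le_nhds
    filter_upwards [self_mem_nhdsWithin,
      hcont.eventually (hgeom.eventually_mem (sphere_subset_closedBall hz))]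
      with t (ht : 0 < t) hmem
    rw [zero_smul, add_zero, zero_mul, add_zero]
    refine hmax (hmem ?_)
    rw [mem_closedBall, dist_eq_norm, show z + t • (z - p j) - p j = (1 + t) • (z - p j) by module,
      norm_smul, ← dist_eq_norm z, mem_sphere.1 hz, Real.norm_of_nonneg (by positivity)]
    nlinarith
  have hin : 0 ≤ ⟪(r j)⁻¹ • (p j - z), gradient u z⟫ := by
    rw [real_inner_comm, inner_gradient_left, ← neg_sub z, smul_neg, map_neg, map_smul,
      smul_eq_mul]
    have := mul_nonpos_of_nonneg_of_nonpos (inv_nonneg.2 hr.le) hderiv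
    linarith
  have := hR j z hz
  nlinarith

theorem IsCondSol.le_of_frontier_le {m : ℕ} {γ : ℝ} (hγ : 0 < γ) {Om : Set (E (m + 1))}
    {p : Fin 2 → E (m + 1)} {r : Fin 2 → ℝ} (hgeom : CondGeom Om p r) {φ : E (m + 1) → ℝ}
    {U : Fin 2 → ℝ} {u : E (m + 1) → ℝ} (h : IsCondSol γ Om p r φ U u) {C : ℝ}
    (hC : ∀ x ∈ frontier Om, φ x ≤ C) :
    (∀ x ∈ Om \ (closedBall (p 0) (r 0) ∪ closedBall (p 1) (r 1)), u x ≤ C) ∧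
      ∀ j, U j ≤ C := by
  obtain ⟨hc, h2, hl, hd, -, -, -, hb⟩ := id h
  set W := Om \ (closedBall (p 0) (r 0) ∪ closedBall (p 1) (r 1)) with hWdef
  have hWo : IsOpen W := hgeom.1.sdiff (isClosed_closedBall.union isClosed_closedBall)
  have hK : IsCompact (closure W) := (hgeom.2.1.subset sdiff_subset).isCompact_closure
  have hle : ∀ x ∈ closure W, u x ≤ C := by
    by_contra! hcon
    obtain ⟨x₀, hx₀, hx₀C⟩ := hcon
    obtain ⟨y, hy, hymax⟩ := hK.exists_isMaxOn ⟨x₀, hx₀⟩ hc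
    have hyC : C < u y := hx₀C.trans_le (hymax hx₀)
    have hZc : IsCompact (closure W ∩ u ⁻¹' {u y}) :=
      hK.of_isClosed_subset (hc.preimage_isClosed_of_isClosed isClosed_closure isClosed_singleton)
        inter_subset_left
    obtain ⟨z, ⟨hzK, hzy : u z = u y⟩, hzmax⟩ := hZc.exists_isMaxOn ⟨y, hy, rfl⟩
      (f := fun x : E (m + 1) => x 0) (by fun_prop)
    have hzmax' : ∀ x ∈ closure W, u x = u y → x 0 ≤ z 0 := fun x hx hxy => hzmax ⟨hx, hxy⟩
    have hopf : ∀ q, DifferentiableAt ℝ u q → u q = u y → q 0 = z 0 →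
        fderiv ℝ u q (EuclideanSpace.single 0 1) = 0 → ¬ ∀ᶠ x in 𝓝 q, q 0 < x 0 → x ∈ W := by
      intro q hdq hqy hqz hfd hev
      obtain ⟨δ, hδ, hsub⟩ := nhds_basis_closedBall.eventually_iff.1 hev
      refine (fderiv_single_neg_of_half_ball hWo h2 hl hδ (fun x hx hlt => ?_) hdq).ne hfd
      have hxW := hsub (by rwa [mem_closedBall, dist_eq_norm]) hlt
      refine ⟨hxW, lt_of_le_of_ne (hqy ▸ hymax (subset_closure hxW)) fun he => ?_⟩
      have := hzmax' x (subset_closure hxW) (he.trans hqy)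
      linarith
    rcases hgeom.closure_subset hzK with hzf | hzW | ⟨j, hzj⟩
    · have := hC z hzf
      rw [← hb z hzf] at this
      linarith
    · have hmax : IsLocalMax u z := by
        filter_upwards [hWo.mem_nhds hzW] with x hx
        exact hzy ▸ hymax (subset_closure hx)
      refine hopf z (hd z (Or.inl (Or.inl hzW))) hzy rfl (by simp [hmax.fderiv_eq_zero]) ?_
      filter_upwards [hWo.mem_nhds hzW] with x hx _ using hx
    · have hr := hgeom.2.2.1 j
      have hUj : u y ≤ U j := hzy ▸ h.le_of_isMaxOn_of_mem_sphere hγ hgeom hzj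
        fun x hx => by
          have : u x ≤ u z := hzy ▸ hymax (subset_closure hx)
          exact this
      have hSK := hgeom.sphere_subset_closure j
      obtain ⟨hq1, hq2⟩ := h.pole hγ hgeom j fun x hx => (hymax (hSK hx)).trans hUj
      set q : E (m + 1) := p j + r j • EuclideanSpace.single 0 1 with hq
      have hqS : q ∈ sphere (p j) (r j) := by simp [q, norm_smul, abs_of_pos hr]
      have hqy : u q = u y := le_antisymm (hymax (hSK hqS)) (hq1 ▸ hUj)
      have hq0 : q 0 = p j 0 + r j := by simp [q]
      have hball : ∀ x ∈ closedBall (p j) (r j), x 0 ≤ q 0 := fun x hx => by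
        rw [mem_closedBall, dist_eq_norm] at hx
        have h1 := (PiLp.norm_apply_le (x - p j) 0).trans hx
        have h2 := (le_abs_self _).trans h1
        rw [PiLp.sub_apply] at h2
        linarith
      refine hopf q (hd q (sphere_subset_union_spheres _ p r j hqS)) hqy (le_antisymm (hzmax' q (hSK hqS) hqy)
        (hball z (sphere_subset_closedBall hzj))) hq2 ?_
      filter_upwards [hgeom.eventually_mem (sphere_subset_closedBall hqS)] with x hx hlt
      exact hx fun hxb => (hball x hxb).not_gt hlt
  refine ⟨fun x hx => hle x (subset_closure hx), fun j => ?_⟩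
  by_contra! hCU
  have hSK := hgeom.sphere_subset_closure j
  have h1 := (h.pole hγ hgeom j fun x hx => (hle x (hSK hx)).trans hCU.le).1
  have h2 := hle _ (hSK (show p j + r j • EuclideanSpace.single 0 1 ∈ sphere (p j) (r j) by
    simp [norm_smul, abs_of_pos (hgeom.2.2.1 j)]))
  linarith

/-- Lemma 2.1 (maximum principle bounds for `u` and `U_j`). -/
theorem maximum_principle_bounds (n : ℕ) (hn : 2 ≤ n) (γ : ℝ) (hγ : 0 < γ)
    (Om : Set (E n)) (p : Fin 2 → E n) (r : Fin 2 → ℝ) (hgeom : CondGeom Om p r)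
    (φ : E n → ℝ) (hφ : ContinuousOn φ (frontier Om))
    (U : Fin 2 → ℝ) (u : E n → ℝ) (hu : IsCondSol γ Om p r φ U u) :
    (∀ x ∈ Om \ (closedBall (p 0) (r 0) ∪ closedBall (p 1) (r 1)),
      sInf (φ '' frontier Om) ≤ u x ∧ u x ≤ sSup (φ '' frontier Om)) ∧
    (∀ j : Fin 2, sInf (φ '' frontier Om) ≤ U j ∧ U j ≤ sSup (φ '' frontier Om)) := by
  obtain ⟨m, rfl⟩ : ∃ m, n = m + 1 := ⟨n - 1, by omega⟩
  have hfr : IsCompact (frontier Om) :=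
    hgeom.2.1.isCompact_closure.of_isClosed_subset isClosed_frontier frontier_subset_closure
  have himg := hfr.image_of_continuousOn hφ
  obtain ⟨hup, hUup⟩ := hu.le_of_frontier_le hγ hgeom (C := sSup (φ '' frontier Om))
    fun x hx => le_csSup himg.bddAbove (mem_image_of_mem φ hx)
  obtain ⟨hlo, hUlo⟩ := hu.neg.le_of_frontier_le hγ hgeom (C := -sInf (φ '' frontier Om))
    fun x hx => neg_le_neg (csInf_le himg.bddBelow (mem_image_of_mem φ hx))
  exact ⟨fun x hx => ⟨neg_le_neg_iff.1 (hlo x hx), hup x hx⟩,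
    fun j => ⟨neg_le_neg_iff.1 (hUlo j), hUup j⟩⟩
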